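/- Let R be an associative ring with unit and let (A, B) be a hereditary complete cotorsion pair in Mod R with kernel ω = A ∩ B. Then pd_A(A) < ∞ if and only if A ⊆ ω^∨ and pd(ω) < ∞; and in this case pd_A(A) = pd(ω) = id_ω(A). -/

import Mathlib

noncomputable section

open CategoryTheory CategoryTheory.Limits Opposite DirectSum

universe u

namespace CotorsionDim

variable {R : Type u} [Ring R]

/-- `Ext^n_R(M,N) = 0`. -/
def ExtZero (M N : ModuleCat.{u} R) (n : ℕ) : Prop :=
  IsZero (((Ext ℤ (ModuleCat.{u} R) n).obj (op M)).obj N)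

/-- A pair of composable maps forms a short exact sequence `0 → A → B → C → 0`. -/
def IsSES {A B C : ModuleCat.{u} R} (f : A ⟶ B) (g : B ⟶ C) : Prop :=
  ∃ w : f ≫ g = 0, (CategoryTheory.ShortComplex.mk f g w).ShortExact

/-- relative projective dimension `pd_𝒳(M)` -/
def rpd (𝒳 : Set (ModuleCat.{u} R)) (M : ModuleCat.{u} R) : ℕ∞ :=
  sInf {n : ℕ∞ | ∀ j : ℕ, n < (j : ℕ∞) → ∀ X ∈ 𝒳, ExtZero M X j}

/-- relative injective dimension `id_𝒳(M)` -/
def rid (𝒳 : Set (ModuleCat.{u} R)) (M : ModuleCat.{u} R) : ℕ∞ :=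
  sInf {n : ℕ∞ | ∀ j : ℕ, n < (j : ℕ∞) → ∀ X ∈ 𝒳, ExtZero X M j}

/-- `pd_𝒳(𝒴)` -/
def rpdClass (𝒳 𝒴 : Set (ModuleCat.{u} R)) : ℕ∞ := ⨆ Y : 𝒴, rpd 𝒳 Y

/-- `id_𝒳(𝒴)` -/
def ridClass (𝒳 𝒴 : Set (ModuleCat.{u} R)) : ℕ∞ := ⨆ Y : 𝒴, rid 𝒳 Y

/-- projective dimension -/
def pd (M : ModuleCat.{u} R) : ℕ∞ := rpd Set.univ M

/-- injective dimension -/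
def idim (M : ModuleCat.{u} R) : ℕ∞ := rid Set.univ M

/-- `pd(𝒴)` -/
def pdClass (𝒴 : Set (ModuleCat.{u} R)) : ℕ∞ := ⨆ Y : 𝒴, pd Y.1

/-- `id(𝒴)` -/
def idClass (𝒴 : Set (ModuleCat.{u} R)) : ℕ∞ := ⨆ Y : 𝒴, idim Y.1

/-- `M` has an `𝒳`-resolution `0 → X_n → ⋯ → X_0 → M → 0` of length `n`. -/
def HasResLen (𝒳 : Set (ModuleCat.{u} R)) : ℕ → ModuleCat.{u} R → Prop
  | 0, M => M ∈ 𝒳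
  | n+1, M => ∃ (K X : ModuleCat.{u} R) (f : K ⟶ X) (g : X ⟶ M),
      X ∈ 𝒳 ∧ IsSES f g ∧ HasResLen 𝒳 n K

/-- `M` has an `𝒳`-coresolution `0 → M → X_0 → ⋯ → X_n → 0` of length `n`. -/
def HasCoresLen (𝒳 : Set (ModuleCat.{u} R)) : ℕ → ModuleCat.{u} R → Prop
  | 0, M => M ∈ 𝒳
  | n+1, M => ∃ (X C : ModuleCat.{u} R) (f : M ⟶ X) (g : X ⟶ C),
      X ∈ 𝒳 ∧ IsSES f g ∧ HasCoresLen 𝒳 n C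

/-- `resdim_𝒳(M)` -/
def resdim (𝒳 : Set (ModuleCat.{u} R)) (M : ModuleCat.{u} R) : ℕ∞ :=
  ⨅ n : {n : ℕ // HasResLen 𝒳 n M}, (n : ℕ∞)

/-- `coresdim_𝒳(M)` -/
def coresdim (𝒳 : Set (ModuleCat.{u} R)) (M : ModuleCat.{u} R) : ℕ∞ :=
  ⨅ n : {n : ℕ // HasCoresLen 𝒳 n M}, (n : ℕ∞)

/-- `resdim_𝒳(𝒴)` -/
def resdimClass (𝒳 𝒴 : Set (ModuleCat.{u} R)) : ℕ∞ := ⨆ Y : 𝒴, resdim 𝒳 Y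

/-- `coresdim_𝒳(𝒴)` -/
def coresdimClass (𝒳 𝒴 : Set (ModuleCat.{u} R)) : ℕ∞ := ⨆ Y : 𝒴, coresdim 𝒳 Y

/-- `𝒳^∧`, the class of modules with a finite `𝒳`-resolution. -/
def resClosure (𝒳 : Set (ModuleCat.{u} R)) : Set (ModuleCat.{u} R) :=
  {M | ∃ n, HasResLen 𝒳 n M}

/-- `𝒳^∨`, the class of modules with a finite `𝒳`-coresolution. -/
def coresClosure (𝒳 : Set (ModuleCat.{u} R)) : Set (ModuleCat.{u} R) :=
  {M | ∃ n, HasCoresLen 𝒳 n M}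

/-- `(𝒜, ℬ)` is a cotorsion pair. -/
def IsCotorsionPair (𝒜 ℬ : Set (ModuleCat.{u} R)) : Prop :=
  (∀ M, M ∈ 𝒜 ↔ ∀ B ∈ ℬ, ExtZero M B 1) ∧
  (∀ M, M ∈ ℬ ↔ ∀ A ∈ 𝒜, ExtZero A M 1)

/-- completeness of a cotorsion pair -/
def IsComplete (𝒜 ℬ : Set (ModuleCat.{u} R)) : Prop :=
  ∀ M : ModuleCat.{u} R,
    (∃ (B A : ModuleCat.{u} R) (f : B ⟶ A) (g : A ⟶ M), B ∈ ℬ ∧ A ∈ 𝒜 ∧ IsSES f g) ∧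
    (∃ (B A : ModuleCat.{u} R) (f : M ⟶ B) (g : B ⟶ A), B ∈ ℬ ∧ A ∈ 𝒜 ∧ IsSES f g)

/-- heredity of a cotorsion pair -/
def IsHereditary (𝒜 ℬ : Set (ModuleCat.{u} R)) : Prop :=
  ∀ i : ℕ, 1 ≤ i → ∀ A ∈ 𝒜, ∀ B ∈ ℬ, ExtZero A B i

variable (R)

/-- `𝒫`, the class of modules of finite projective dimension. -/
def P : Set (ModuleCat.{u} R) := {M | pd M < ⊤}

variable {R}

/-- `M` admits a projective resolution consisting of finitely generated projectives,
i.e. `M ∈ mod R`. -/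
def InmodR (M : ModuleCat.{u} R) : Prop :=
  ∃ K : ℕ → ModuleCat.{u} R, K 0 = M ∧ ∀ i : ℕ,
    ∃ (Q : ModuleCat.{u} R) (f : K (i+1) ⟶ Q) (g : Q ⟶ K i),
      Module.Finite R Q ∧ Projective Q ∧ IsSES f g

variable (R)

/-- `𝒫^{<∞} = 𝒫 ∩ mod R`. -/
def Pfin : Set (ModuleCat.{u} R) := {M | pd M < ⊤ ∧ InmodR M}

/-- the big finitistic dimension -/
def bigFindim : ℕ∞ := pdClass (P R)

/-- the little finitistic dimension -/
def littleFindim : ℕ∞ := pdClass (Pfin R)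

variable {R}

/-- `𝒳^{⊥₁}` -/
def rperp1 (𝒳 : Set (ModuleCat.{u} R)) : Set (ModuleCat.{u} R) :=
  {M | ∀ X ∈ 𝒳, ExtZero X M 1}

/-- `^{⊥₁}𝒳` -/
def lperp1 (𝒳 : Set (ModuleCat.{u} R)) : Set (ModuleCat.{u} R) :=
  {M | ∀ X ∈ 𝒳, ExtZero M X 1}

/-- `T^⊥ = {M : Ext^i(T,M) = 0 for all i > 0}` -/
def rperpAll (T : ModuleCat.{u} R) : Set (ModuleCat.{u} R) :=
  {M | ∀ i : ℕ, 0 < i → ExtZero T M i}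

/-- `Add T`: direct summands of arbitrary direct sums of copies of `T`. -/
def AddT (T : ModuleCat.{u} R) : Set (ModuleCat.{u} R) :=
  {M | ∃ (I : Type u) (s : M ⟶ ModuleCat.of R (I →₀ T)) (r : ModuleCat.of R (I →₀ T) ⟶ M),
    s ≫ r = 𝟙 M}

/-- `T` is a tilting module. -/
def IsTilting (T : ModuleCat.{u} R) : Prop :=
  pd T < ⊤ ∧
  (∀ i : ℕ, 0 < i → ∀ I : Type u, ExtZero T (ModuleCat.of R (I →₀ T)) i) ∧
  ∃ n, HasCoresLen (AddT T) n (ModuleCat.of R R)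


/-- `𝒳` is closed under arbitrary direct sums (coproducts). -/
def ClosedUnderCoproducts (𝒳 : Set (ModuleCat.{u} R)) : Prop :=
  ∀ (I : Type u) (f : I → ModuleCat.{u} R), (∀ i, f i ∈ 𝒳) →
    ModuleCat.of R (⨁ i, (f i : Type u)) ∈ 𝒳

/-- `𝒳` is closed under direct summands. -/
def ClosedUnderSummands (𝒳 : Set (ModuleCat.{u} R)) : Prop :=
  ∀ (M N : ModuleCat.{u} R) (s : M ⟶ N) (r : N ⟶ M), s ≫ r = 𝟙 M → N ∈ 𝒳 → M ∈ 𝒳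

/-- In positive degrees, vanishing of the left derived functor `Ext` agrees with vanishing of
the `Ext`-groups defined through the derived category. -/
lemma extZero_succ_iff (M N : ModuleCat.{u} R) (n : ℕ) :
    ExtZero M N (n + 1) ↔ Subsingleton (Abelian.Ext M N (n + 1)) := by
  have P := projectiveResolution M
  have hexact : ExtZero M N (n + 1) ↔ ∀ f : P.complex.X (n + 1) ⟶ N,
      P.complex.d (n + 2) (n + 1) ≫ f = 0 →
        ∃ g : P.complex.X n ⟶ N, P.complex.d (n + 1) n ≫ g = f := by
    unfold ExtZero
    rw [(P.isoExt (R := ℤ) (n + 1) N).isZero_iff,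
      ← HomologicalComplex.exactAt_iff_isZero_homology,
      HomologicalComplex.exactAt_iff' _ n (n + 1) (n + 2) (by simp) (by simp),
      ShortComplex.moduleCat_exact_iff]
    rfl
  rw [hexact]
  refine ⟨fun h ↦ subsingleton_of_forall_eq 0 fun α ↦ ?_, fun h f hf ↦ ?_⟩
  · obtain ⟨f, hf, rfl⟩ := P.extMk_surjective α (n + 2) rfl
    exact (P.extMk_eq_zero_iff f (n + 2) rfl hf n rfl).2 (h f hf)
  · exact (P.extMk_eq_zero_iff f (n + 2) rfl hf n rfl).1 (Subsingleton.elim _ _)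

lemma extZero_iff (M N : ModuleCat.{u} R) {j : ℕ} (hj : 1 ≤ j) :
    ExtZero M N j ↔ ∀ x : Abelian.Ext M N j, x = 0 := by
  obtain ⟨n, rfl⟩ := Nat.exists_eq_add_of_le' hj
  rw [extZero_succ_iff]
  exact ⟨fun h x ↦ Subsingleton.elim _ _, fun h ↦ subsingleton_of_forall_eq 0 h⟩

section LongExactSequences

variable {K L N : ModuleCat.{u} R} {f : K ⟶ L} {g : L ⟶ N} {j : ℕ}

lemma IsSES.extZero_to_right (h : IsSES f g) (X : ModuleCat.{u} R) (hj : 1 ≤ j)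
    (hL : ExtZero X L j) (hK : ExtZero X K (j + 1)) : ExtZero X N j := by
  obtain ⟨w, hS⟩ := h
  rw [extZero_iff _ _ hj] at hL ⊢
  rw [extZero_iff _ _ (by lia)] at hK
  intro x
  obtain ⟨y, rfl⟩ := Abelian.Ext.covariant_sequence_exact₃ X hS x rfl (hK _)
  rw [hL y, Abelian.Ext.zero_comp]

lemma IsSES.extZero_from_middle (h : IsSES f g) (Y : ModuleCat.{u} R) (hj : 1 ≤ j)
    (hK : ExtZero K Y j) (hN : ExtZero N Y j) : ExtZero L Y j := by
  obtain ⟨w, hS⟩ := h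
  rw [extZero_iff _ _ hj] at hK hN ⊢
  intro x
  obtain ⟨y, rfl⟩ := Abelian.Ext.contravariant_sequence_exact₂ hS Y x (hK _)
  rw [hN y, Abelian.Ext.comp_zero]

lemma IsSES.extZero_from_left (h : IsSES f g) (Y : ModuleCat.{u} R) (hj : 1 ≤ j)
    (hL : ExtZero L Y j) (hN : ExtZero N Y (j + 1)) : ExtZero K Y j := by
  obtain ⟨w, hS⟩ := h
  rw [extZero_iff _ _ hj] at hL ⊢
  rw [extZero_iff _ _ (by lia)] at hN
  intro x
  obtain ⟨y, rfl⟩ := Abelian.Ext.contravariant_sequence_exact₁ hS Y x (add_comm 1 j) (hN _)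
  rw [hL y, Abelian.Ext.comp_zero]

end LongExactSequences

lemma rpd_le_iff {𝒳 : Set (ModuleCat.{u} R)} {M : ModuleCat.{u} R} {n : ℕ∞} :
    rpd 𝒳 M ≤ n ↔ ∀ j : ℕ, n < j → ∀ X ∈ 𝒳, ExtZero M X j := by
  refine ⟨fun h j hj ↦ ?_, fun h ↦ sInf_le h⟩
  have hmem := csInf_mem
    (s := {n : ℕ∞ | ∀ j : ℕ, n < (j : ℕ∞) → ∀ X ∈ 𝒳, ExtZero M X j})
    ⟨⊤, fun j hj ↦ absurd hj (by simp)⟩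
  exact hmem j (h.trans_lt hj)

lemma rid_le_iff {𝒳 : Set (ModuleCat.{u} R)} {M : ModuleCat.{u} R} {n : ℕ∞} :
    rid 𝒳 M ≤ n ↔ ∀ j : ℕ, n < j → ∀ X ∈ 𝒳, ExtZero X M j := by
  refine ⟨fun h j hj ↦ ?_, fun h ↦ sInf_le h⟩
  have hmem := csInf_mem
    (s := {n : ℕ∞ | ∀ j : ℕ, n < (j : ℕ∞) → ∀ X ∈ 𝒳, ExtZero X M j})
    ⟨⊤, fun j hj ↦ absurd hj (by simp)⟩
  exact hmem j (h.trans_lt hj)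

lemma rpdClass_le_iff {𝒳 𝒴 : Set (ModuleCat.{u} R)} {n : ℕ∞} :
    rpdClass 𝒳 𝒴 ≤ n ↔ ∀ j : ℕ, n < j → ∀ Y ∈ 𝒴, ∀ X ∈ 𝒳, ExtZero Y X j := by
  simp only [rpdClass, iSup_le_iff, rpd_le_iff, Subtype.forall]
  exact ⟨fun h j hj Y hY ↦ h Y hY j hj, fun h Y hY j hj ↦ h j hj Y hY⟩

lemma ridClass_le_iff {𝒳 𝒴 : Set (ModuleCat.{u} R)} {n : ℕ∞} :
    ridClass 𝒳 𝒴 ≤ n ↔ ∀ j : ℕ, n < j → ∀ Y ∈ 𝒴, ∀ X ∈ 𝒳, ExtZero X Y j := by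
  simp only [ridClass, iSup_le_iff, rid_le_iff, Subtype.forall]
  exact ⟨fun h j hj Y hY ↦ h Y hY j hj, fun h Y hY j hj ↦ h j hj Y hY⟩

lemma pdClass_le_iff {𝒴 : Set (ModuleCat.{u} R)} {n : ℕ∞} :
    pdClass 𝒴 ≤ n ↔ ∀ j : ℕ, n < j → ∀ Y ∈ 𝒴, ∀ N, ExtZero Y N j := by
  rw [show pdClass 𝒴 = rpdClass Set.univ 𝒴 from rfl, rpdClass_le_iff]
  simp

lemma one_le_of_enat_lt {n : ℕ∞} {j : ℕ} (h : n < j) : 1 ≤ j :=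
  Nat.one_le_iff_ne_zero.2 fun hj ↦ by simp [hj] at h

lemma ridClass_le_pdClass (𝒳 𝒴 : Set (ModuleCat.{u} R)) : ridClass 𝒳 𝒴 ≤ pdClass 𝒳 :=
  ridClass_le_iff.2 fun j hj Y _ X hX ↦ pdClass_le_iff.1 le_rfl j hj X hX Y

lemma ridClass_le_rpdClass_of_subset {𝒳 𝒴 : Set (ModuleCat.{u} R)} (h : 𝒳 ⊆ 𝒴) :
    ridClass 𝒳 𝒴 ≤ rpdClass 𝒴 𝒴 :=
  ridClass_le_iff.2 fun j hj Y hY X hX ↦ rpdClass_le_iff.1 le_rfl j hj X (h hX) Y hY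

/-- Projective dimensions of modules in `𝒜` are detected by `Ext` with values in `𝒜`. -/
lemma pdClass_le_ridClass {𝒜 ℬ 𝒳 : Set (ModuleCat.{u} R)} (hcomp : IsComplete 𝒜 ℬ)
    (hher : IsHereditary 𝒜 ℬ) (h𝒳 : 𝒳 ⊆ 𝒜) : pdClass 𝒳 ≤ ridClass 𝒳 𝒜 := by
  refine pdClass_le_iff.2 fun j hj X hX N ↦ ?_
  obtain ⟨B, A, f, g, hB, hA, hfg⟩ := (hcomp N).1
  exact hfg.extZero_to_right X (one_le_of_enat_lt hj)
    (ridClass_le_iff.1 le_rfl j hj A hA X hX) (hher _ (by lia) X (h𝒳 hX) B hB)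

lemma HasCoresLen.extZero {𝒳 : Set (ModuleCat.{u} R)} {k : ℕ} {M : ModuleCat.{u} R}
    (h : HasCoresLen 𝒳 k M) (j : ℕ) (hj : pdClass 𝒳 < j) (N : ModuleCat.{u} R) :
    ExtZero M N j := by
  induction k generalizing M j with
  | zero => exact pdClass_le_iff.1 le_rfl j hj M h N
  | succ k ih =>
    obtain ⟨X, C, f, g, hX, hfg, hC⟩ := h
    exact hfg.extZero_from_left N (one_le_of_enat_lt hj)
      (pdClass_le_iff.1 le_rfl j hj X hX N)
      (ih hC (j + 1) (hj.trans (by exact_mod_cast j.lt_succ_self)))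

lemma rpdClass_le_pdClass_of_subset_coresClosure {𝒳 𝒴 𝒵 : Set (ModuleCat.{u} R)}
    (h : 𝒴 ⊆ coresClosure 𝒳) : rpdClass 𝒵 𝒴 ≤ pdClass 𝒳 :=
  rpdClass_le_iff.2 fun j hj _ hY Z _ ↦ (h hY).choose_spec.extZero j hj Z

lemma hasCoresLen_kernel {𝒜 ℬ : Set (ModuleCat.{u} R)} (hcp : IsCotorsionPair 𝒜 ℬ)
    (hcomp : IsComplete 𝒜 ℬ) (hher : IsHereditary 𝒜 ℬ) {n : ℕ} {M : ModuleCat.{u} R}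
    (hM : M ∈ 𝒜) (hn : ∀ j : ℕ, n < j → ∀ X ∈ 𝒜, ExtZero X M j) :
    HasCoresLen (𝒜 ∩ ℬ) n M := by
  induction n generalizing M with
  | zero => exact ⟨hM, (hcp.2 M).2 (hn 1 one_pos)⟩
  | succ n ih =>
    obtain ⟨B, A, f, g, hB, hA, hfg⟩ := (hcomp M).2
    refine ⟨B, A, f, g, ⟨(hcp.1 B).2 fun Y hY ↦ ?_, hB⟩, hfg, ih hA fun j hj X hX ↦ ?_⟩
    · exact hfg.extZero_from_middle Y le_rfl ((hcp.1 M).1 hM Y hY) ((hcp.1 A).1 hA Y hY)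
    · exact hfg.extZero_to_right X (by lia) (hher j (by lia) X hX B hB)
        (hn (j + 1) (by lia) X hX)

lemma subset_coresClosure_kernel {𝒜 ℬ : Set (ModuleCat.{u} R)} (hcp : IsCotorsionPair 𝒜 ℬ)
    (hcomp : IsComplete 𝒜 ℬ) (hher : IsHereditary 𝒜 ℬ) (h : rpdClass 𝒜 𝒜 < ⊤) :
    𝒜 ⊆ coresClosure (𝒜 ∩ ℬ) := by
  intro M hM
  obtain ⟨n, hn⟩ := ENat.ne_top_iff_exists.1 h.ne
  exact ⟨n, hasCoresLen_kernel hcp hcomp hher hM fun j hj X hX ↦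
    rpdClass_le_iff.1 hn.ge j (by exact_mod_cast hj) X hX M hM⟩

/-- Theorem 2.5(b): `pd_𝒜(𝒜) < ∞` iff `𝒜 ⊆ ω^∨` and `pd ω < ∞`; in this case
`pd_𝒜(𝒜) = pd ω = id_ω(𝒜)`. -/
theorem stmt8 {R : Type u} [Ring R] (𝒜 ℬ ω : Set (ModuleCat.{u} R))
    (hcp : IsCotorsionPair 𝒜 ℬ) (hcomp : IsComplete 𝒜 ℬ) (hher : IsHereditary 𝒜 ℬ)
    (hω : ω = 𝒜 ∩ ℬ) :
    (rpdClass 𝒜 𝒜 < ⊤ ↔ (𝒜 ⊆ coresClosure ω ∧ pdClass ω < ⊤)) ∧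
    (rpdClass 𝒜 𝒜 < ⊤ →
      rpdClass 𝒜 𝒜 = pdClass ω ∧ pdClass ω = ridClass ω 𝒜) := by
  subst hω
  have hpd := pdClass_le_ridClass hcomp hher (Set.inter_subset_left (s := 𝒜) (t := ℬ))
  have hrid := ridClass_le_rpdClass_of_subset (Set.inter_subset_left (s := 𝒜) (t := ℬ))
  refine ⟨⟨fun h ↦ ⟨subset_coresClosure_kernel hcp hcomp hher h, (hpd.trans hrid).trans_lt h⟩,
    fun ⟨hsub, h⟩ ↦ (rpdClass_le_pdClass_of_subset_coresClosure hsub).trans_lt h⟩, fun h ↦ ?_⟩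
  exact ⟨(rpdClass_le_pdClass_of_subset_coresClosure
    (subset_coresClosure_kernel hcp hcomp hher h)).antisymm (hpd.trans hrid),
    hpd.antisymm (ridClass_le_pdClass _ _)⟩

end CotorsionDim
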